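/- arXiv:2509.20019 — 4 statements merged into one kernel-verified Lean document; each statement's English description precedes it below -/
import Mathlib

section
/- Let E be a real Banach space and equip E × E with the norm N(x,y) = √(2‖x‖² + 2‖y‖²). The linear map f : E × E → E × E defined by f(x,y) = ((x+y)/√2, (x−y)/√2) satisfies f ∘ f = id, and f is norm-nonincreasing with respect to N if and only if there exists a real inner product ⟨·,·⟩ on E inducing its norm (i.e. ⟨x,x⟩ = ‖x‖² for all x), that is, if and only if E is a Hilbert space. -/
/-- The norm `N(x,y) = √(2‖x‖² + 2‖y‖²)` on `E × E`. -/
noncomputable def pairNorm (E : Type*) [NormedAddCommGroup E] (p : E × E) : ℝ :=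
  Real.sqrt (2 * ‖p.1‖ ^ 2 + 2 * ‖p.2‖ ^ 2)

/-- The linear map `f(x,y) = ((x+y)/√2, (x−y)/√2)` on `E × E`. -/
noncomputable def rotMap (E : Type*) [NormedAddCommGroup E] [NormedSpace ℝ E]
    (p : E × E) : E × E :=
  ((Real.sqrt 2)⁻¹ • (p.1 + p.2), (Real.sqrt 2)⁻¹ • (p.1 - p.2))

/-- The map `rotMap` is an involution. -/
theorem rotMap_rotMap (E : Type*) [NormedAddCommGroup E] [NormedSpace ℝ E] (p : E × E) :
    rotMap E (rotMap E p) = p := by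
  have h : (Real.sqrt 2)⁻¹ * (Real.sqrt 2)⁻¹ = (2 : ℝ)⁻¹ := by
    rw [← mul_inv, Real.mul_self_sqrt zero_le_two]
  ext
  · simp only [rotMap, ← smul_add, smul_smul, h]
    module
  · simp only [rotMap, ← smul_sub, smul_smul, h]
    module

/-- The norm of `rotMap E p` in terms of the two diagonals `x + y` and `x - y`. -/
theorem pairNorm_rotMap (E : Type*) [NormedAddCommGroup E] [NormedSpace ℝ E] (p : E × E) :
    pairNorm E (rotMap E p) = Real.sqrt (‖p.1 + p.2‖ ^ 2 + ‖p.1 - p.2‖ ^ 2) := by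
  simp only [pairNorm, rotMap, norm_smul, mul_pow, norm_inv, inv_pow, Real.norm_eq_abs, sq_abs,
    Real.sq_sqrt zero_le_two]
  congr 1
  ring

/-- An involution which does not increase `pairNorm` preserves it, so nonexpansiveness of `rotMap`
is the parallelogram law. -/
theorem rotMap_nonexpansive_iff_parallelogram (E : Type*) [NormedAddCommGroup E]
    [NormedSpace ℝ E] :
    (∀ p : E × E, pairNorm E (rotMap E p) ≤ pairNorm E p) ↔
      ∀ x y : E, ‖x + y‖ * ‖x + y‖ + ‖x - y‖ * ‖x - y‖ = 2 * (‖x‖ * ‖x‖ + ‖y‖ * ‖y‖) := by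
  constructor
  · intro h x y
    have h₁ := h (x, y)
    have h₂ := h (rotMap E (x, y))
    rw [rotMap_rotMap] at h₂
    have h₃ := le_antisymm h₁ h₂
    rw [pairNorm_rotMap, pairNorm, Real.sqrt_inj (by positivity) (by positivity)] at h₃
    linear_combination h₃
  · intro h p
    rw [pairNorm_rotMap, pairNorm]
    apply Real.sqrt_le_sqrt
    linarith [h p.1 p.2]

/-- The Fréchet–von Neumann–Jordan theorem, phrased with `InnerProductSpace.Core`. -/
theorem parallelogram_iff_exists_core (E : Type*) [NormedAddCommGroup E] [NormedSpace ℝ E] :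
    (∀ x y : E, ‖x + y‖ * ‖x + y‖ + ‖x - y‖ * ‖x - y‖ = 2 * (‖x‖ * ‖x‖ + ‖y‖ * ‖y‖)) ↔
      ∃ c : InnerProductSpace.Core ℝ E, ∀ x : E, c.inner x x = ‖x‖ ^ 2 := by
  constructor
  · intro h
    let : InnerProductSpace ℝ E := InnerProductSpace.ofNorm ℝ h
    exact ⟨InnerProductSpace.toCore, fun x => real_inner_self_eq_norm_sq x⟩
  · rintro ⟨c, hc⟩ x y
    let : InnerProductSpace ℝ E :=
      { inner := c.inner
        norm_sq_eq_re_inner := fun x => (hc x).symm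
        conj_inner_symm := c.conj_inner_symm
        add_left := c.add_left
        smul_left := c.smul_left }
    simpa only [sq] using parallelogram_law_with_norm ℝ x y

/-- For a real Banach space `E`, the map `f(x,y) = ((x+y)/√2, (x−y)/√2)` is an
involution, and it is norm-nonincreasing for `N(x,y) = √(2‖x‖² + 2‖y‖²)` if and
only if the norm of `E` is induced by a real inner product, i.e. `E` is a
Hilbert space. -/
theorem rotMap_involution_and_nonexpansive_iff_hilbert (E : Type*)
    [NormedAddCommGroup E] [NormedSpace ℝ E] [CompleteSpace E] :
    (∀ p : E × E, rotMap E (rotMap E p) = p) ∧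
      ((∀ p : E × E, pairNorm E (rotMap E p) ≤ pairNorm E p) ↔
        ∃ c : InnerProductSpace.Core ℝ E, ∀ x : E, c.inner x x = ‖x‖ ^ 2) := by
  exact ⟨rotMap_rotMap E,
    (rotMap_nonexpansive_iff_parallelogram E).trans (parallelogram_iff_exists_core E)⟩
end

section
/- Let X be an extended metric space. On the disjoint union Y = (X × {n ∈ ℕ : n ≥ 1}) ⊔ X define a distance D by: D((x,n),(y,m)) = edist(x,y) + 1/n + 1/m whenever (x,n) ≠ (y,m); D((x,n), y) = D(y, (x,n)) = edist(x,y) + 1/n for y in the second summand X; D(y,z) = edist(y,z) for y, z in the second summand; and D(p,p) = 0 for every p. Then D is an extended metric on Y, the first summand X × {n ≥ 1} is dense in Y (so its inclusion into Y is a nonexpanding map with dense range), and the inclusion of the second summand X into Y is an isometric embedding. -/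
open scoped ENNReal

open Classical in
/-- The distance on the disjoint union `(X × {n ≥ 1}) ⊕ X`:
`D((x,n),(y,m)) = edist x y + 1/n + 1/m` for distinct points of the first summand,
`D((x,n), y) = edist x y + 1/n` across the two summands,
`D(y,z) = edist y z` on the second summand, and `D(p,p) = 0`. -/
noncomputable def sumDist (X : Type*) [EMetricSpace X] :
    ((X × {n : ℕ // 1 ≤ n}) ⊕ X) → ((X × {n : ℕ // 1 ≤ n}) ⊕ X) → ℝ≥0∞
  | Sum.inl a, Sum.inl b =>
      if a = b then 0
      else edist a.1 b.1 + ((a.2 : ℕ) : ℝ≥0∞)⁻¹ + ((b.2 : ℕ) : ℝ≥0∞)⁻¹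
  | Sum.inl a, Sum.inr y => edist a.1 y + ((a.2 : ℕ) : ℝ≥0∞)⁻¹
  | Sum.inr y, Sum.inl a => edist a.1 y + ((a.2 : ℕ) : ℝ≥0∞)⁻¹
  | Sum.inr y, Sum.inr z => edist y z

/-- The projection of `(X × {n ≥ 1}) ⊕ X` onto `X`. -/
def sumBase (X : Type*) : (X × {n : ℕ // 1 ≤ n}) ⊕ X → X :=
  Sum.elim Prod.fst id

/-- The height above `X` of a point of `(X × {n ≥ 1}) ⊕ X`: `1/n` at `(x, n)`, and `0` on the
second summand. -/
noncomputable def sumHeight (X : Type*) : (X × {n : ℕ // 1 ≤ n}) ⊕ X → ℝ≥0∞ :=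
  Sum.elim (fun a => ((a.2 : ℕ) : ℝ≥0∞)⁻¹) 0

theorem sumDist_self {X : Type*} [EMetricSpace X] (p : (X × {n : ℕ // 1 ≤ n}) ⊕ X) :
    sumDist X p p = 0 := by
  cases p <;> simp [sumDist]

theorem sumDist_of_ne {X : Type*} [EMetricSpace X] {p q : (X × {n : ℕ // 1 ≤ n}) ⊕ X}
    (h : p ≠ q) :
    sumDist X p q = edist (sumBase X p) (sumBase X q) + sumHeight X p + sumHeight X q := by
  rcases p with a | y <;> rcases q with b | z
  · have hab : a ≠ b := fun e => h (congrArg _ e)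
    simp [sumDist, sumBase, sumHeight, hab]
  · simp [sumDist, sumBase, sumHeight]
  · simp [sumDist, sumBase, sumHeight, edist_comm]
  · simp [sumDist, sumBase, sumHeight]

theorem sumDist_comm {X : Type*} [EMetricSpace X] (p q : (X × {n : ℕ // 1 ≤ n}) ⊕ X) :
    sumDist X p q = sumDist X q p := by
  rcases eq_or_ne p q with rfl | h
  · rfl
  · rw [sumDist_of_ne h, sumDist_of_ne h.symm, edist_comm, add_right_comm]

theorem sumDist_triangle {X : Type*} [EMetricSpace X] (p q r : (X × {n : ℕ // 1 ≤ n}) ⊕ X) :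
    sumDist X p r ≤ sumDist X p q + sumDist X q r := by
  rcases eq_or_ne p r with rfl | hpr
  · simp [sumDist_self]
  rcases eq_or_ne p q with rfl | hpq
  · simp [sumDist_self]
  rcases eq_or_ne q r with rfl | hqr
  · simp [sumDist_self]
  rw [sumDist_of_ne hpr, sumDist_of_ne hpq, sumDist_of_ne hqr]
  calc edist (sumBase X p) (sumBase X r) + sumHeight X p + sumHeight X r
      ≤ edist (sumBase X p) (sumBase X q) + edist (sumBase X q) (sumBase X r)
          + sumHeight X p + sumHeight X r := by
        gcongr
        exact edist_triangle _ _ _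
    _ ≤ edist (sumBase X p) (sumBase X q) + edist (sumBase X q) (sumBase X r)
          + sumHeight X p + sumHeight X r + (sumHeight X q + sumHeight X q) := le_self_add
    _ = _ := by ring

theorem eq_of_sumDist_eq_zero {X : Type*} [EMetricSpace X]
    {p q : (X × {n : ℕ // 1 ≤ n}) ⊕ X} (h : sumDist X p q = 0) : p = q := by
  by_contra hne
  rw [sumDist_of_ne hne] at h
  rcases p with a | y <;> rcases q with b | z <;> simp [sumBase, sumHeight] at h
  exact hne (congrArg _ h)

/-- The extended metric space structure on `(X × {n ≥ 1}) ⊕ X` given by `sumDist`. -/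
@[reducible]
noncomputable def sumDistEMetricSpace (X : Type*) [EMetricSpace X] :
    EMetricSpace ((X × {n : ℕ // 1 ≤ n}) ⊕ X) where
  edist := sumDist X
  edist_self := sumDist_self
  edist_comm := sumDist_comm
  edist_triangle := sumDist_triangle
  eq_of_edist_eq_zero := eq_of_sumDist_eq_zero

theorem exists_sumDist_inl_lt {X : Type*} [EMetricSpace X] (p : (X × {n : ℕ // 1 ≤ n}) ⊕ X)
    {ε : ℝ≥0∞} (hε : 0 < ε) : ∃ a, sumDist X p (Sum.inl a) < ε := by
  rcases p with a | y
  · exact ⟨a, by rwa [sumDist_self]⟩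
  · obtain ⟨n, hn⟩ := ENNReal.exists_inv_nat_lt hε.ne'
    have hn1 : 1 ≤ n := by
      rcases Nat.eq_zero_or_pos n with rfl | h
      · simp at hn
      · exact h
    exact ⟨(y, ⟨n, hn1⟩), by simpa [sumDist] using hn⟩

theorem dense_range_of_forall_exists_edist_lt {α ι : Type*} [PseudoEMetricSpace α] {f : ι → α}
    (h : ∀ x : α, ∀ ε > 0, ∃ i, edist x (f i) < ε) : Dense (Set.range f) := fun x =>
  EMetric.mem_closure_iff.2 fun ε hε =>
    let ⟨i, hi⟩ := h x ε hε
    ⟨f i, Set.mem_range_self i, hi⟩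

/-- `sumDist` is an extended metric on `Y = (X × {n ≥ 1}) ⊕ X`, for which the first
summand is dense and the inclusion of the second summand is an isometric embedding. -/
theorem sumDist_emetric_dense_isometry (X : Type*) [EMetricSpace X] :
    ∃ inst : EMetricSpace ((X × {n : ℕ // 1 ≤ n}) ⊕ X),
      (∀ p q, @edist _ inst.toPseudoEMetricSpace.toEDist p q = sumDist X p q) ∧
      (@Dense _ (@UniformSpace.toTopologicalSpace _ inst.toPseudoEMetricSpace.toUniformSpace)
        (Set.range (Sum.inl : X × {n : ℕ // 1 ≤ n} → (X × {n : ℕ // 1 ≤ n}) ⊕ X))) ∧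
      (@Isometry X ((X × {n : ℕ // 1 ≤ n}) ⊕ X) _ inst.toPseudoEMetricSpace Sum.inr) := by
  exact ⟨sumDistEMetricSpace X, fun _ _ => rfl,
    @dense_range_of_forall_exists_edist_lt _ _ (sumDistEMetricSpace X).toPseudoEMetricSpace _
      fun p _ hε => exists_sumDist_inl_lt p hε,
    fun _ _ => rfl⟩
end

section
/- Let X be an extended metric space which is connected as a topological space. If X is dense-stable — that is, for every nonexpanding map e : A → B between extended metric spaces with dense range, the post-composition map g ↦ e ∘ g, from the set of nonexpanding maps X → A to the set of nonexpanding maps X → B equipped with the supremum extended metric, has dense range — then X has at most one point. -/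
open scoped ENNReal

universe u

/-- A map between (pseudo-)extended metric spaces is nonexpanding if it does not
increase extended distances. -/
def Nonexpanding {α β : Type*} [PseudoEMetricSpace α] [PseudoEMetricSpace β]
    (f : α → β) : Prop :=
  ∀ x y, edist (f x) (f y) ≤ edist x y

/-- An extended metric space `X` is dense-stable if for every nonexpanding map
`e : A → B` between extended metric spaces with dense range, the post-composition map
`g ↦ e ∘ g` from nonexpanding maps `X → A` to nonexpanding maps `X → B` has dense
range with respect to the supremum extended metric: for every nonexpanding `h : X → B`
and every `δ > 0` there is a nonexpanding `g : X → A` with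
`⨆ x, edist (e (g x)) (h x) < δ`. -/
def DenseStable (X : Type u) [EMetricSpace X] : Prop :=
  ∀ (A B : Type u) [EMetricSpace A] [EMetricSpace B] (e : A → B),
    Nonexpanding e → DenseRange e →
      ∀ h : X → B, Nonexpanding h →
        ∀ δ : ℝ≥0∞, 0 < δ →
          ∃ g : X → A, Nonexpanding g ∧ (⨆ x, edist (e (g x)) (h x)) < δ

/-- The extended metric for which distinct points are at infinite distance. -/
@[reducible]
noncomputable def EMetricSpace.discreteTop (X : Type*) : EMetricSpace X := by
  classical
  exact
    { edist := fun x y => if x = y then 0 else ⊤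
      edist_self := fun x => by simp
      edist_comm := fun x y => by simp only [eq_comm]
      edist_triangle := fun x y z => by
        by_cases hxy : x = y <;> by_cases hyz : y = z <;> simp_all
      eq_of_edist_eq_zero := fun {x y} h => by
        by_contra hxy
        simp [hxy] at h }

theorem EMetricSpace.discreteTop_edist_of_ne {X : Type*} {x y : X} (h : x ≠ y) :
    (EMetricSpace.discreteTop X).edist x y = ⊤ :=
  if_neg h

/-- A map from a connected space which identifies points at finite distance is constant. -/
theorem apply_eq_of_forall_edist_lt_top {X Y : Type*} [PseudoEMetricSpace X]
    [PreconnectedSpace X] {g : X → Y} (hg : ∀ x y, edist x y < ⊤ → g x = g y) (x y : X) :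
    g x = g y := by
  have hloc : IsLocallyConstant g := (IsLocallyConstant.iff_eventually_eq g).2 fun z =>
    Filter.mem_of_superset (Metric.eball_mem_nhds z ENNReal.zero_lt_top) fun w hw => hg w z hw
  exact hloc.apply_eq_of_preconnectedSpace x y

/-- A connected dense-stable extended metric space has at most one point. -/
theorem subsingleton_of_connected_denseStable (X : Type u) [EMetricSpace X]
    [ConnectedSpace X] (hX : DenseStable X) : Subsingleton X := by
  refine ⟨fun x y => ?_⟩
  by_contra hxy
  have hpos : 0 < edist x y / 2 := ENNReal.half_pos (edist_pos.2 hxy).ne'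
  obtain ⟨g, hg, hlt⟩ := @hX X X (EMetricSpace.discreteTop X) _ id
    (fun a b => by
      by_cases hab : a = b
      · simp [hab]
      · exact le_top.trans_eq (EMetricSpace.discreteTop_edist_of_ne hab).symm)
    Function.surjective_id.denseRange id (fun _ _ => le_rfl) _ hpos
  have hconst : g x = g y := apply_eq_of_forall_edist_lt_top (fun a b hab => by
    by_contra hne
    exact (hg a b).not_gt
      (hab.trans_eq (EMetricSpace.discreteTop_edist_of_ne hne).symm)) x y
  have hclose : ∀ z, edist (g z) z < edist x y / 2 := fun z =>
    (le_iSup (fun z => edist (g z) z) z).trans_lt hlt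
  have hx := hclose x
  have hy := hclose y
  rw [← hconst] at hy
  have := (edist_triangle_left x y (g x)).trans_lt (ENNReal.add_lt_add hx hy)
  rw [ENNReal.add_halves] at this
  exact this.false
end

section
/- Let C be a category with pullbacks in which every morphism admits a strong epi–mono factorization. Let f : S → Z be a morphism, m : T → Z a monomorphism, P the pullback of f along m, and r : P → T the projection (so that the composite P → Z equals m ∘ r). Then r is an isomorphism if and only if r is a monomorphism and m factors through the image of the composite m ∘ r : P → Z (equivalently, T ≤ im(m ∘ r) as subobjects of Z). (This is the content, for the (strong epimorphism, monomorphism) factorization system, of the paper's characterization of satisfaction of limit sequents: the '∃!!' condition — existence plus M-uniqueness — holds precisely when the pullback projection is invertible.) -/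
open CategoryTheory CategoryTheory.Limits

universe v u

/-- In a category with pullbacks and strong epi–mono factorizations, given `f : S ⟶ Z`
and a monomorphism `m : T ⟶ Z`, the pullback projection `r : P ⟶ T` (where `P` is the
pullback of `f` along `m`) is an isomorphism if and only if `r` is a monomorphism and
`m` factors through the image of the composite `m ∘ r : P ⟶ Z`
(i.e. `T ≤ im(m ∘ r)` as subobjects of `Z`). -/
theorem pullback_snd_isIso_iff_mono_and_factors {C : Type u} [Category.{v} C]
    [HasPullbacks C] [HasStrongEpiMonoFactorisations C]
    {S Z T : C} (f : S ⟶ Z) (m : T ⟶ Z) [Mono m] :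
    IsIso (pullback.snd f m) ↔
      (Mono (pullback.snd f m) ∧
        ∃ k : T ⟶ image (pullback.snd f m ≫ m),
          k ≫ image.ι (pullback.snd f m ≫ m) = m) := by
  constructor
  · intro _
    exact ⟨inferInstance, inv (pullback.snd f m) ≫ factorThruImage _, by simp⟩
  · rintro ⟨_, k, hk⟩
    have hsection :
        (k ≫ (imageMonoIsoSource (pullback.snd f m ≫ m)).hom) ≫ pullback.snd f m = 𝟙 T := by
      rw [← cancel_mono m, Category.assoc, Category.assoc, imageMonoIsoSource_hom_self, hk,
        Category.id_comp]
    have : IsSplitEpi (pullback.snd f m) := IsSplitEpi.mk' ⟨_, hsection⟩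
    exact isIso_of_mono_of_isSplitEpi _
end
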